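/- Let d ≥ 1 and y₁, …, y_{d+1} ∈ ℝ^d with y_{d+1} = 0. Then there exists a constant C > 0 such that for all w ∈ ℝ^d, | det( (y₁ − w)^ − (y₂ − w)^, (y₂ − w)^ − (y₃ − w)^, …, (y_d − w)^ − (y_{d+1} − w)^ ) | ≤ C (1 + ‖w‖)^{−(d+1)}. (This is the decay estimate that makes the integrand of the geometric identity absolutely integrable over ℝ^d; by the Clifford trace–determinant identity it is equivalent to the bound |tr(γ₀ ∏_{i=1}^d γ·(ŷᵢ−w − ŷᵢ₊₁−w))| ≤ C'(1+‖w‖)^{−(d+1)} for even d.) -/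

import Mathlib

open scoped Classical

/-- The normalization map: `v̂ = v/‖v‖` if `v ≠ 0`, and `0̂ = 0`. -/
noncomputable def unitHat {d : ℕ} (v : EuclideanSpace ℝ (Fin d)) : EuclideanSpace ℝ (Fin d) :=
  if v = 0 then 0 else ‖v‖⁻¹ • v

/-- The determinant-form integrand
`w ↦ det((y₁ − w)^ − (y₂ − w)^, …, (y_d − w)^ − (y_{d+1} − w)^)`,
where the `j`-th column of the matrix is `(y_j − w)^ − (y_{j+1} − w)^`. -/
noncomputable def detIntegrand {d : ℕ} (y : Fin (d + 1) → EuclideanSpace ℝ (Fin d))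
    (w : EuclideanSpace ℝ (Fin d)) : ℝ :=
  (Matrix.of fun i j : Fin d =>
    (unitHat (y j.castSucc - w) - unitHat (y j.succ - w)) i).det

theorem norm_smul_unitHat {d : ℕ} (v : EuclideanSpace ℝ (Fin d)) : ‖v‖ • unitHat v = v := by
  by_cases h : v = 0
  · simp [h]
  · simp [unitHat, h, smul_smul]

theorem norm_unitHat {d : ℕ} {v : EuclideanSpace ℝ (Fin d)} (h : v ≠ 0) : ‖unitHat v‖ = 1 := by
  simp [unitHat, h, norm_smul]

theorem norm_unitHat_le_one {d : ℕ} (v : EuclideanSpace ℝ (Fin d)) : ‖unitHat v‖ ≤ 1 := by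
  by_cases h : v = 0
  · simp [unitHat, h]
  · exact (norm_unitHat h).le

theorem norm_mul_norm_unitHat_sub_le {d : ℕ} (x z : EuclideanSpace ℝ (Fin d)) :
    ‖z‖ * ‖unitHat x - unitHat z‖ ≤ 2 * ‖x - z‖ := by
  have key : ‖z‖ • (unitHat x - unitHat z) = (‖z‖ - ‖x‖) • unitHat x + (x - z) := by
    rw [smul_sub, sub_smul, norm_smul_unitHat, norm_smul_unitHat]
    abel
  calc ‖z‖ * ‖unitHat x - unitHat z‖ = ‖(‖z‖ - ‖x‖) • unitHat x + (x - z)‖ := by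
        rw [← key, norm_smul, norm_norm]
    _ ≤ |‖z‖ - ‖x‖| * ‖unitHat x‖ + ‖x - z‖ := by
        simpa [norm_smul] using norm_add_le ((‖z‖ - ‖x‖) • unitHat x) (x - z)
    _ ≤ ‖x - z‖ * 1 + ‖x - z‖ := by
        gcongr
        · rw [norm_sub_rev x z]
          exact abs_norm_sub_norm_le z x
        · exact norm_unitHat_le_one x
    _ = 2 * ‖x - z‖ := by ring

/-- The component of `x̂` along a unit vector `u` differs from `1` by at most `‖x̂ - u‖²`. -/
theorem abs_one_sub_inner_unitHat_le {d : ℕ} (x u : EuclideanSpace ℝ (Fin d)) (hu : ‖u‖ = 1) :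
    |1 - inner ℝ (unitHat x) u| ≤ ‖unitHat x - u‖ ^ 2 := by
  by_cases h : x = 0
  · simp [unitHat, h, hu]
  · have hsq := norm_sub_sq_real (unitHat x) u
    rw [norm_unitHat h, hu] at hsq
    rw [abs_le]
    constructor <;> nlinarith [sq_nonneg ‖unitHat x - u‖]

theorem abs_det_le_factorial_mul_prod {n : Type*} [Fintype n] [DecidableEq n]
    (A : Matrix n n ℝ) (r : n → ℝ) (h : ∀ i j, |A i j| ≤ r i) :
    |A.det| ≤ (Fintype.card n).factorial * ∏ i, r i := by
  rw [← Matrix.det_transpose, Matrix.det_apply]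
  calc |∑ σ : Equiv.Perm n, Equiv.Perm.sign σ • ∏ i, A.transpose (σ i) i|
      ≤ ∑ σ : Equiv.Perm n, |Equiv.Perm.sign σ • ∏ i, A.transpose (σ i) i| :=
        Finset.abs_sum_le_sum_abs _ _
    _ ≤ ∑ _σ : Equiv.Perm n, ∏ i, r i := by
        refine Finset.sum_le_sum fun σ _ => ?_
        have hs : |Equiv.Perm.sign σ • ∏ i, A.transpose (σ i) i| = ∏ i, |A i (σ i)| := by
          rcases Int.units_eq_one_or (Equiv.Perm.sign σ) with hσ | hσ <;>
            simp [hσ, Finset.abs_prod]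
        rw [hs]
        exact Finset.prod_le_prod (fun i _ => abs_nonneg _) fun i _ => h i (σ i)
    _ = (Fintype.card n).factorial * ∏ i, r i := by
        simp [Fintype.card_perm]

/-- If all entries of `A` are at most `ε` and all components of its columns along a unit vector `u`
are at most `ε ^ 2`, then `|det A|` gains one extra factor `ε`. -/
theorem abs_det_le_of_inner_le {d : ℕ} (A : Matrix (Fin d) (Fin d) ℝ)
    (u : EuclideanSpace ℝ (Fin d)) (hu : ‖u‖ = 1) (ε : ℝ) (hA : ∀ i j, |A i j| ≤ ε)
    (hAu : ∀ j, |∑ i, u i * A i j| ≤ ε ^ 2) :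
    |A.det| ≤ d * (d.factorial * ε ^ (d + 1)) := by
  have hrow (k : Fin d) : |u k * A.det| ≤ d.factorial * ε ^ (d + 1) := by
    have hdet : (A.updateRow k (∑ i, u i • A i)).det = u k * A.det := by
      simpa using Matrix.det_updateRow_sum A k (fun i => u i)
    rw [← hdet]
    refine (abs_det_le_factorial_mul_prod _ (Function.update (fun _ => ε) k (ε ^ 2))
      fun i j => ?_).trans_eq ?_
    · by_cases hik : i = k
      · subst hik
        simpa using hAu j
      · simpa [hik] using hA i j
    · have hd : d = (d - 1) + 1 := by have := k.pos; omega
      rw [Finset.prod_update_of_mem (Finset.mem_univ k)]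
      simp only [Finset.prod_const, Fintype.card_fin, Finset.card_sdiff, Finset.card_univ,
        Finset.card_singleton, Finset.inter_univ]
      rw [← pow_add]
      congr 2
      omega
  have hsum : ∑ k, u k ^ 2 = 1 := by
    have := EuclideanSpace.real_norm_sq_eq u
    rw [hu] at this
    linarith
  have hle (k : Fin d) : |u k| ≤ 1 := by
    simpa [hu] using PiLp.norm_apply_le u k
  calc |A.det| = |∑ k, u k * (u k * A.det)| := by
        congr 1
        simp_rw [← mul_assoc, ← sq]
        rw [← Finset.sum_mul, hsum, one_mul]
    _ ≤ ∑ k, |u k * (u k * A.det)| := Finset.abs_sum_le_sum_abs _ _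
    _ ≤ ∑ _k : Fin d, d.factorial * ε ^ (d + 1) := by
        refine Finset.sum_le_sum fun k _ => ?_
        rw [abs_mul]
        exact (mul_le_of_le_one_left (abs_nonneg _) (hle k)).trans (hrow k)
    _ = d * (d.factorial * ε ^ (d + 1)) := by simp

theorem abs_detIntegrand_le_of_norm_ge_one {d : ℕ} (y : Fin (d + 1) → EuclideanSpace ℝ (Fin d))
    (M : ℝ) (hM : ∀ i, ‖y i‖ ≤ M) (w : EuclideanSpace ℝ (Fin d)) (hw : 1 ≤ ‖w‖) :
    |detIntegrand y w| ≤ d * (d.factorial * (8 * M / (1 + ‖w‖)) ^ (d + 1)) := by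
  have hM0 : 0 ≤ M := (norm_nonneg _).trans (hM 0)
  have hw0 : -w ≠ 0 := by
    rw [neg_ne_zero, ← norm_pos_iff]
    linarith
  set u := unitHat (-w) with hu_def
  have hu : ‖u‖ = 1 := norm_unitHat hw0
  set δ := 4 * M / (1 + ‖w‖) with hδ
  have hε : 8 * M / (1 + ‖w‖) = 2 * δ := by rw [hδ]; ring
  rw [hε]
  have hclose (i : Fin (d + 1)) : ‖unitHat (y i - w) - u‖ ≤ δ := by
    have h := norm_mul_norm_unitHat_sub_le (y i - w) (-w)
    rw [norm_neg, sub_neg_eq_add, sub_add_cancel, ← hu_def] at h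
    rw [hδ, le_div_iff₀ (by linarith)]
    nlinarith [hM i, norm_nonneg (unitHat (y i - w) - u)]
  have hinner (i : Fin (d + 1)) : |1 - inner ℝ (unitHat (y i - w)) u| ≤ δ ^ 2 :=
    (abs_one_sub_inner_unitHat_le _ u hu).trans
      (pow_le_pow_left₀ (norm_nonneg _) (hclose i) 2)
  refine abs_det_le_of_inner_le _ u hu (2 * δ) (fun i j => ?_) fun j => ?_
  · calc |(unitHat (y j.castSucc - w) - unitHat (y j.succ - w)) i|
        ≤ ‖unitHat (y j.castSucc - w) - unitHat (y j.succ - w)‖ :=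
          (Real.norm_eq_abs _).symm.trans_le (PiLp.norm_apply_le _ i)
      _ ≤ ‖unitHat (y j.castSucc - w) - u‖ + ‖u - unitHat (y j.succ - w)‖ :=
          norm_sub_le_norm_sub_add_norm_sub _ _ _
      _ ≤ 2 * δ := by
          rw [norm_sub_rev u]
          linarith [hclose j.castSucc, hclose j.succ]
  · have hsum : ∑ i, u i * (unitHat (y j.castSucc - w) - unitHat (y j.succ - w)) i =
        inner ℝ (unitHat (y j.castSucc - w)) u - inner ℝ (unitHat (y j.succ - w)) u := by
      rw [← inner_sub_left, PiLp.inner_apply]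
      simp
    simp only [Matrix.of_apply]
    rw [hsum]
    have h₁ := abs_le.mp (hinner j.castSucc)
    have h₂ := abs_le.mp (hinner j.succ)
    rw [abs_le]
    constructor <;> nlinarith [sq_nonneg δ]

theorem abs_detIntegrand_le {d : ℕ} (y : Fin (d + 1) → EuclideanSpace ℝ (Fin d))
    (w : EuclideanSpace ℝ (Fin d)) : |detIntegrand y w| ≤ d.factorial * 2 ^ d := by
  refine (abs_det_le_factorial_mul_prod _ (fun _ => 2) fun i j => ?_).trans_eq (by simp)
  calc |(unitHat (y j.castSucc - w) - unitHat (y j.succ - w)) i|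
      ≤ ‖unitHat (y j.castSucc - w) - unitHat (y j.succ - w)‖ :=
          (Real.norm_eq_abs _).symm.trans_le (PiLp.norm_apply_le _ i)
    _ ≤ ‖unitHat (y j.castSucc - w)‖ + ‖unitHat (y j.succ - w)‖ := norm_sub_le _ _
    _ ≤ 2 := by
        linarith [norm_unitHat_le_one (y j.castSucc - w), norm_unitHat_le_one (y j.succ - w)]

/-- the decay estimate
`|det((y₁−w)^ − (y₂−w)^, …, (y_d−w)^ − (y_{d+1}−w)^)| ≤ C (1 + ‖w‖)^{−(d+1)}`
for some constant `C > 0`, uniformly in `w ∈ ℝ^d`. -/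
theorem det_integrand_decay {d : ℕ} (hd : 1 ≤ d)
    (y : Fin (d + 1) → EuclideanSpace ℝ (Fin d)) (hy : y (Fin.last d) = 0) :
    ∃ C > 0, ∀ w : EuclideanSpace ℝ (Fin d),
      |detIntegrand y w| ≤ C * ((1 + ‖w‖) ^ (d + 1))⁻¹ := by
  obtain ⟨M, hM⟩ : ∃ M, ∀ i, ‖y i‖ ≤ M := ⟨∑ i, ‖y i‖, fun i =>
    Finset.single_le_sum (f := fun i => ‖y i‖) (fun i _ => norm_nonneg _) (Finset.mem_univ i)⟩
  have hM0 : 0 ≤ M := (norm_nonneg _).trans (hM 0)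
  have hd' : (1 : ℝ) ≤ d := by exact_mod_cast hd
  refine ⟨d * (d.factorial * (8 * M + 4) ^ (d + 1)), by positivity, fun w => ?_⟩
  have hw0 := norm_nonneg w
  have hC : d * (d.factorial * (8 * M + 4) ^ (d + 1)) * ((1 + ‖w‖) ^ (d + 1))⁻¹ =
      d * (d.factorial * ((8 * M + 4) / (1 + ‖w‖)) ^ (d + 1)) := by
    rw [div_pow]
    ring
  rw [hC]
  rcases le_total 1 ‖w‖ with hw | hw
  · refine (abs_detIntegrand_le_of_norm_ge_one y M hM w hw).trans ?_
    have h8 : 8 * M / (1 + ‖w‖) ≤ (8 * M + 4) / (1 + ‖w‖) :=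
      div_le_div_of_nonneg_right (by linarith) (by linarith)
    have h80 : 0 ≤ 8 * M / (1 + ‖w‖) := by positivity
    exact mul_le_mul_of_nonneg_left (mul_le_mul_of_nonneg_left
      (pow_le_pow_left₀ h80 h8 (d + 1)) (Nat.cast_nonneg _)) (Nat.cast_nonneg _)
  · have h2 : 2 ≤ (8 * M + 4) / (1 + ‖w‖) := by
      rw [le_div_iff₀ (by linarith)]
      linarith
    calc |detIntegrand y w| ≤ d.factorial * 2 ^ d := abs_detIntegrand_le y w
      _ ≤ d.factorial * 2 ^ (d + 1) := by
          exact mul_le_mul_of_nonneg_left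
            (pow_le_pow_right₀ one_le_two d.le_succ) (Nat.cast_nonneg _)
      _ ≤ d.factorial * ((8 * M + 4) / (1 + ‖w‖)) ^ (d + 1) := by gcongr
      _ ≤ d * (d.factorial * ((8 * M + 4) / (1 + ‖w‖)) ^ (d + 1)) :=
          le_mul_of_one_le_left (by positivity) hd'
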